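/- Let α : [0,1] → X be a continuous map and let S be a nonempty chain (linearly ordered subset) in the partially ordered set 𝓛(α) of loop-cancellations of α, where X permits loop deletion and α(0) ≠ α(1). Let V = ⋃_{𝒰 ∈ S} ⋃𝒰 and let 𝒱 be the set of connected components of V. Then 𝒱 is a loop-cancellation of α, and 𝒱 is an upper bound for S in 𝓛(α). -/

import Mathlib

/-- A space `X` permits loop deletion: for every path `α : [0,1] → X` and all
sequences `(aₙ)` nonincreasing to `0` and `(bₙ)` nondecreasing to `1` in `[0,1]`
with `a₀ < b₀` and `α (aₙ) = α (bₙ)` for all `n`, one has `α 0 = α 1`. -/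
def PermitsLoopDeletion (X : Type*) [TopologicalSpace X] : Prop :=
  ∀ α : ℝ → X, ContinuousOn α (Set.Icc 0 1) →
    ∀ a b : ℕ → ℝ, (∀ n, a n ∈ Set.Icc (0 : ℝ) 1) → (∀ n, b n ∈ Set.Icc (0 : ℝ) 1) →
      Antitone a → Monotone b → a 0 < b 0 →
      Filter.Tendsto a Filter.atTop (nhds 0) →
      Filter.Tendsto b Filter.atTop (nhds 1) →
      (∀ n : ℕ, α (a n) = α (b n)) → α 0 = α 1

/-- A loop-cancellation of a path `α : [0,1] → X`: a set of pairwise-disjoint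
open intervals `(a,b) ⊆ [0,1]` (encoded by their endpoint pairs) such that
`α a = α b` for each interval. -/
def IsLoopCancellation {X : Type*} (α : ℝ → X) (U : Set (ℝ × ℝ)) : Prop :=
  (∀ p ∈ U, 0 ≤ p.1 ∧ p.1 < p.2 ∧ p.2 ≤ 1 ∧ α p.1 = α p.2) ∧
  U.Pairwise fun p q => Disjoint (Set.Ioo p.1 p.2) (Set.Ioo q.1 q.2)

/-- The partial order on loop-cancellations: `U ≤ V` iff every interval of `U`
is contained in some interval of `V`. -/
def LCle (U V : Set (ℝ × ℝ)) : Prop :=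
  ∀ p ∈ U, ∃ q ∈ V, Set.Ioo p.1 p.2 ⊆ Set.Ioo q.1 q.2

/-- `U` is a maximal loop-cancellation of `α`: any loop-cancellation above it
is also below it (hence equal to it). -/
def IsMaximalLoopCancellation {X : Type*} (α : ℝ → X) (U : Set (ℝ × ℝ)) : Prop :=
  IsLoopCancellation α U ∧
    ∀ V : Set (ℝ × ℝ), IsLoopCancellation α V → LCle U V → LCle V U

open Set Filter Topology in
/-- Loop deletion on an arbitrary interval, along nested intervals exhausting it. -/
theorem PermitsLoopDeletion.eq_of_tendsto {X : Type*} [TopologicalSpace X]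
    (hX : PermitsLoopDeletion X) {α : ℝ → X} {c d : ℝ} (hcd : c < d)
    (hα : ContinuousOn α (Icc c d)) {a b : ℕ → ℝ} (ha : Antitone a) (hb : Monotone b)
    (hab : a 0 < b 0) (hac : Tendsto a atTop (𝓝 c)) (hbd : Tendsto b atTop (𝓝 d))
    (h : ∀ n, α (a n) = α (b n)) : α c = α d := by
  have hpos : 0 < d - c := sub_pos.2 hcd
  have hca : ∀ n, c ≤ a n := ha.le_of_tendsto hac
  have hbd' : ∀ n, b n ≤ d := hb.ge_of_tendsto hbd
  have hab' : ∀ n, a n < b n := fun n =>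
    (ha n.zero_le).trans_lt (hab.trans_le (hb n.zero_le))
  have key : ∀ t, c + (t - c) / (d - c) * (d - c) = t := fun t => by
    field_simp; ring
  have mem : ∀ t, c ≤ t → t ≤ d → (t - c) / (d - c) ∈ Icc (0 : ℝ) 1 := fun t h1 h2 =>
    ⟨div_nonneg (sub_nonneg.2 h1) hpos.le, (div_le_one hpos).2 (by linarith)⟩
  have lim : ∀ {u : ℕ → ℝ} {l : ℝ}, Tendsto u atTop (𝓝 l) →
      Tendsto (fun n => (u n - c) / (d - c)) atTop (𝓝 ((l - c) / (d - c))) :=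
    fun hu => (hu.sub_const c).div_const _
  have := hX (fun t => α (c + t * (d - c)))
    (hα.comp (by fun_prop) fun t ht => ⟨by nlinarith [ht.1], by nlinarith [ht.2]⟩)
    (fun n => (a n - c) / (d - c)) (fun n => (b n - c) / (d - c))
    (fun n => mem _ (hca n) ((hab' n).le.trans (hbd' n)))
    (fun n => mem _ ((hca n).trans (hab' n).le) (hbd' n))
    (fun m n hmn => div_le_div_of_nonneg_right (sub_le_sub_right (ha hmn) _) hpos.le)
    (fun m n hmn => div_le_div_of_nonneg_right (sub_le_sub_right (hb hmn) _) hpos.le)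
    (div_lt_div_of_pos_right (sub_lt_sub_right hab _) hpos)
    (by simpa using lim hac) (by simpa [div_self hpos.ne'] using lim hbd)
    (fun n => by simpa only [key] using h n)
  simpa using this

/-- The intervals of members of `S` that contain `x`. -/
def intervalsAt (S : Set (Set (ℝ × ℝ))) (x : ℝ) : Set (ℝ × ℝ) :=
  {p | ∃ U ∈ S, p ∈ U ∧ x ∈ Set.Ioo p.1 p.2}

theorem nested_of_mem_intervalsAt {X : Type*} {α : ℝ → X} {S : Set (Set (ℝ × ℝ))}
    (hS : ∀ U ∈ S, IsLoopCancellation α U) (hchain : IsChain LCle S) {x : ℝ} {p q : ℝ × ℝ}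
    (hp : p ∈ intervalsAt S x) (hq : q ∈ intervalsAt S x) :
    (q.1 ≤ p.1 ∧ p.2 ≤ q.2) ∨ (p.1 ≤ q.1 ∧ q.2 ≤ p.2) := by
  have aux : ∀ {U W : Set (ℝ × ℝ)} {p q : ℝ × ℝ}, W ∈ S → p ∈ U → q ∈ W →
      x ∈ Set.Ioo p.1 p.2 → x ∈ Set.Ioo q.1 q.2 → LCle U W → q.1 ≤ p.1 ∧ p.2 ≤ q.2 := by
    intro U W p q hW hpU hqW hxp hxq hle
    obtain ⟨r, hr, hsub⟩ := hle p hpU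
    obtain rfl : r = q := by
      by_contra hrq
      exact Set.disjoint_left.1 ((hS W hW).2 hr hqW hrq) (hsub hxp) hxq
    exact (Set.Ioo_subset_Ioo_iff (hxp.1.trans hxp.2)).1 hsub
  obtain ⟨U, hU, hpU, hxp⟩ := hp
  obtain ⟨W, hW, hqW, hxq⟩ := hq
  by_cases hUW : U = W
  · subst hUW
    exact Or.inl (aux hU hpU hqW hxp hxq fun r hr => ⟨r, hr, subset_rfl⟩)
  · exact (hchain hU hW hUW).imp (aux hW hpU hqW hxp hxq) (aux hU hqW hpU hxq hxp)

open Set in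
theorem exists_connectedComponentIn_eq_Ioo {X : Type*} {α : ℝ → X} {S : Set (Set (ℝ × ℝ))}
    (hS : ∀ U ∈ S, IsLoopCancellation α U) (hchain : IsChain LCle S) {x : ℝ}
    (hx : x ∈ ⋃ U ∈ S, ⋃ p ∈ U, Ioo p.1 p.2) :
    ∃ c d, c < d ∧ IsGLB (Prod.fst '' intervalsAt S x) c ∧
      IsLUB (Prod.snd '' intervalsAt S x) d ∧
      connectedComponentIn (⋃ U ∈ S, ⋃ p ∈ U, Ioo p.1 p.2) x = Ioo c d := by
  set V : Set ℝ := ⋃ U ∈ S, ⋃ p ∈ U, Ioo p.1 p.2 with hV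
  have mem_V : ∀ {y}, y ∈ V ↔ ∃ p, p ∈ intervalsAt S y := by
    intro y
    simp only [hV, mem_iUnion, intervalsAt, mem_ofPred_eq]
    constructor
    · rintro ⟨U, hU, p, hp, hy⟩
      exact ⟨p, U, hU, hp, hy⟩
    · rintro ⟨p, U, hU, hp, hy⟩
      exact ⟨U, hU, p, hp, hy⟩
  have move : ∀ {y z p}, p ∈ intervalsAt S y → z ∈ Ioo p.1 p.2 → p ∈ intervalsAt S z :=
    fun ⟨U, hU, hp, _⟩ hz => ⟨U, hU, hp, hz⟩
  obtain ⟨p₀, hp₀⟩ := mem_V.1 hx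
  have hlo : BddBelow (Prod.fst '' intervalsAt S x) := by
    refine ⟨0, ?_⟩
    rintro _ ⟨p, ⟨U, hU, hp, -⟩, rfl⟩
    exact ((hS U hU).1 p hp).1
  have hhi : BddAbove (Prod.snd '' intervalsAt S x) := by
    refine ⟨1, ?_⟩
    rintro _ ⟨p, ⟨U, hU, hp, -⟩, rfl⟩
    exact ((hS U hU).1 p hp).2.2.1
  have hc := isGLB_csInf (nonempty_of_mem (mem_image_of_mem Prod.fst hp₀)) hlo
  have hd := isLUB_csSup (nonempty_of_mem (mem_image_of_mem Prod.snd hp₀)) hhi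
  generalize sInf (Prod.fst '' intervalsAt S x) = c at hc
  generalize sSup (Prod.snd '' intervalsAt S x) = d at hd
  have hcp : ∀ p ∈ intervalsAt S x, c ≤ p.1 := fun p hp => hc.1 (mem_image_of_mem _ hp)
  have hpd : ∀ p ∈ intervalsAt S x, p.2 ≤ d := fun p hp => hd.1 (mem_image_of_mem _ hp)
  have hxcd : x ∈ Ioo c d := by
    obtain ⟨-, -, -, hxp⟩ := id hp₀
    exact ⟨(hcp _ hp₀).trans_lt hxp.1, hxp.2.trans_le (hpd _ hp₀)⟩
  have cover : ∀ y ∈ Ioo c d, ∃ p ∈ intervalsAt S x, y ∈ Ioo p.1 p.2 := by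
    intro y hy
    obtain ⟨_, ⟨p, hp, rfl⟩, -, hpy⟩ := hc.exists_between hy.1
    obtain ⟨_, ⟨q, hq, rfl⟩, hyq, -⟩ := hd.exists_between hy.2
    rcases nested_of_mem_intervalsAt hS hchain hp hq with h | h
    · exact ⟨q, hq, h.1.trans_lt hpy, hyq⟩
    · exact ⟨p, hp, hpy, hyq.trans_le h.2⟩
  have meet : ∀ q z, q ∈ intervalsAt S z → z ∈ Ioo c d → c ≤ q.1 ∧ q.2 ≤ d := by
    intro q z hq hz
    obtain ⟨p, hp, hzp⟩ := cover z hz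
    rcases nested_of_mem_intervalsAt hS hchain (move hp hzp) hq with h | h
    · have hqx : q ∈ intervalsAt S x := by
        obtain ⟨-, -, -, hxp⟩ := id hp
        exact move hq ⟨h.1.trans_lt hxp.1, hxp.2.trans_le h.2⟩
      exact ⟨hcp q hqx, hpd q hqx⟩
    · exact ⟨(hcp p hp).trans h.1, h.2.trans (hpd p hp)⟩
  have hcd : c < d := hxcd.1.trans hxcd.2
  have hcV : c ∉ V := by
    intro hcV
    obtain ⟨q, hq⟩ := mem_V.1 hcV
    obtain ⟨-, -, -, hcq⟩ := id hq
    obtain ⟨z, hz1, hz2⟩ := exists_between (lt_min hcq.2 hcd)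
    have hz := lt_min_iff.1 hz2
    exact hcq.1.not_ge (meet q z (move hq ⟨hcq.1.trans hz1, hz.1⟩) ⟨hz1, hz.2⟩).1
  have hdV : d ∉ V := by
    intro hdV
    obtain ⟨q, hq⟩ := mem_V.1 hdV
    obtain ⟨-, -, -, hdq⟩ := id hq
    obtain ⟨z, hz1, hz2⟩ := exists_between (max_lt hdq.1 hcd)
    have hz := max_lt_iff.1 hz1
    exact hdq.2.not_ge (meet q z (move hq ⟨hz.1, hz2.trans hdq.2⟩) ⟨hz.2, hz2⟩).2
  refine ⟨c, d, hcd, hc, hd, subset_antisymm (fun y hy => ?_) ?_⟩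
  · have hoc : OrdConnected (connectedComponentIn V x) :=
      isPreconnected_connectedComponentIn.ordConnected
    have hxC := mem_connectedComponentIn hx
    refine ⟨?_, ?_⟩ <;> by_contra! hlt
    · exact hcV (connectedComponentIn_subset V x (hoc.out hy hxC ⟨hlt, hxcd.1.le⟩))
    · exact hdV (connectedComponentIn_subset V x (hoc.out hxC hy ⟨hxcd.2.le, hlt⟩))
  · refine isPreconnected_Ioo.subset_connectedComponentIn hxcd fun y hy => ?_
    obtain ⟨p, hp, hyp⟩ := cover y hy
    exact mem_V.2 ⟨p, move hp hyp⟩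

open Set Filter Topology in
theorem endpoints_eq_of_isGLB_of_isLUB {X : Type*} [TopologicalSpace X]
    (hX : PermitsLoopDeletion X) {α : ℝ → X} (hα : ContinuousOn α (Icc 0 1))
    {S : Set (Set (ℝ × ℝ))} (hS : ∀ U ∈ S, IsLoopCancellation α U) (hchain : IsChain LCle S)
    {x c d : ℝ} (hcd : c < d) (hc : IsGLB (Prod.fst '' intervalsAt S x) c)
    (hd : IsLUB (Prod.snd '' intervalsAt S x) d) : 0 ≤ c ∧ d ≤ 1 ∧ α c = α d := by
  have hprop : ∀ p ∈ intervalsAt S x, 0 ≤ p.1 ∧ p.1 < p.2 ∧ p.2 ≤ 1 ∧ α p.1 = α p.2 :=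
    fun p ⟨U, hU, hp, _⟩ => (hS U hU).1 p hp
  have h0 : 0 ≤ c := by
    refine hc.2 ?_
    rintro _ ⟨p, hp, rfl⟩
    exact (hprop p hp).1
  have h1 : d ≤ 1 := by
    refine hd.2 ?_
    rintro _ ⟨p, hp, rfl⟩
    exact (hprop p hp).2.2.1
  refine ⟨h0, h1, ?_⟩
  have hcp : ∀ p ∈ intervalsAt S x, c ≤ p.1 := fun p hp => hc.1 (mem_image_of_mem _ hp)
  have hpd : ∀ p ∈ intervalsAt S x, p.2 ≤ d := fun p hp => hd.1 (mem_image_of_mem _ hp)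
  have hlen : IsLUB ((fun p : ℝ × ℝ => p.2 - p.1) '' intervalsAt S x) (d - c) := by
    refine ⟨?_, fun u hu => ?_⟩
    · rintro _ ⟨p, hp, rfl⟩
      exact sub_le_sub (hpd p hp) (hcp p hp)
    · refine le_of_forall_pos_lt_add fun ε hε => ?_
      obtain ⟨_, ⟨p, hp, rfl⟩, -, hp'⟩ := hc.exists_between (lt_add_of_pos_right c (half_pos hε))
      obtain ⟨_, ⟨q, hq, rfl⟩, hq', -⟩ := hd.exists_between (sub_lt_self d (half_pos hε))
      have hup := hu (mem_image_of_mem _ hp)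
      have huq := hu (mem_image_of_mem _ hq)
      rcases nested_of_mem_intervalsAt hS hchain hp hq with h | h <;> linarith
  obtain ⟨_, ⟨p₁, hp₁, -⟩, -⟩ := hc.exists_between (lt_add_one c)
  obtain ⟨u, hu, -, hulim, hmem⟩ :=
    hlen.exists_seq_monotone_tendsto (nonempty_of_mem (mem_image_of_mem _ hp₁))
  choose p hp hpu using hmem
  simp only at hpu
  have hmono : ∀ m n, m ≤ n → (p n).1 ≤ (p m).1 ∧ (p m).2 ≤ (p n).2 := by
    intro m n hmn
    have := hu hmn
    rw [← hpu, ← hpu] at this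
    rcases nested_of_mem_intervalsAt hS hchain (hp m) (hp n) with h | h
    · exact h
    · exact ⟨by linarith [h.1, h.2], by linarith [h.1, h.2]⟩
  have hgap : Tendsto (fun n => (d - c) - u n) atTop (𝓝 0) := by
    simpa using hulim.const_sub (d - c)
  refine hX.eq_of_tendsto hcd (hα.mono (Icc_subset_Icc h0 h1))
    (a := fun n => (p n).1) (b := fun n => (p n).2)
    (fun m n hmn => (hmono m n hmn).1) (fun m n hmn => (hmono m n hmn).2)
    (hprop _ (hp 0)).2.1 ?_ ?_ (fun n => (hprop _ (hp n)).2.2.2)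
  · refine tendsto_of_tendsto_of_tendsto_of_le_of_le tendsto_const_nhds
      (by simpa using hgap.const_add c) (fun n => hcp _ (hp n)) fun n => ?_
    dsimp only
    linarith [hpu n, hpd _ (hp n)]
  · refine tendsto_of_tendsto_of_tendsto_of_le_of_le (by simpa using hgap.const_sub d)
      tendsto_const_nhds (fun n => ?_) fun n => hpd _ (hp n)
    dsimp only
    linarith [hpu n, hcp _ (hp n)]

/-- For a chain `S` of loop-cancellations of a non-loop path `α` in a space
permitting loop deletion, the set `𝒱` of connected components of
`V = ⋃_{𝒰 ∈ S} ⋃ 𝒰` is a loop-cancellation of `α` and an upper bound for `S`. -/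
theorem chain_upper_bound
    {X : Type*} [TopologicalSpace X] (hX : PermitsLoopDeletion X)
    (α : ℝ → X) (hα : ContinuousOn α (Set.Icc 0 1)) (hne : α 0 ≠ α 1)
    (S : Set (Set (ℝ × ℝ))) (hS : S.Nonempty)
    (hSlc : ∀ U ∈ S, IsLoopCancellation α U)
    (hchain : IsChain LCle S)
    (V : Set ℝ) (hV : V = ⋃ U ∈ S, ⋃ p ∈ U, Set.Ioo p.1 p.2)
    (comps : Set (ℝ × ℝ))
    (hcomps : comps =
      {p : ℝ × ℝ | p.1 < p.2 ∧ ∃ x ∈ V, connectedComponentIn V x = Set.Ioo p.1 p.2}) :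
    IsLoopCancellation α comps ∧ ∀ U ∈ S, LCle U comps := by
  subst hV hcomps
  refine ⟨⟨?_, ?_⟩, ?_⟩
  · rintro ⟨a, b⟩ ⟨hab, x, hx, hxp⟩
    obtain ⟨c, d, hcd, hc, hd, hC⟩ := exists_connectedComponentIn_eq_Ioo hSlc hchain hx
    dsimp only at hab hxp ⊢
    rw [hC] at hxp
    have h₁ := (Set.Ioo_subset_Ioo_iff hcd).1 hxp.subset
    have h₂ := (Set.Ioo_subset_Ioo_iff hab).1 hxp.superset
    obtain rfl : a = c := le_antisymm h₁.1 h₂.1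
    obtain rfl : b = d := le_antisymm h₂.2 h₁.2
    obtain ⟨h0, h1, heq⟩ := endpoints_eq_of_isGLB_of_isLUB hX hα hSlc hchain hcd hc hd
    exact ⟨h0, hab, h1, heq⟩
  · rintro ⟨a, b⟩ ⟨hab, x, -, hxp⟩ ⟨a', b'⟩ ⟨hab', y, -, hyq⟩ hne'
    rw [← hxp, ← hyq, Set.disjoint_left]
    intro z hzx hzy
    have hEq : Set.Ioo a b = Set.Ioo a' b' :=
      hxp.symm.trans ((connectedComponentIn_eq hzx).trans
        ((connectedComponentIn_eq hzy).symm.trans hyq))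
    have h₁ := (Set.Ioo_subset_Ioo_iff hab).1 hEq.subset
    have h₂ := (Set.Ioo_subset_Ioo_iff hab').1 hEq.superset
    exact hne' (Prod.ext (le_antisymm h₂.1 h₁.1) (le_antisymm h₁.2 h₂.2))
  · intro U hU p hp
    obtain ⟨x, hx⟩ := Set.nonempty_Ioo.2 ((hSlc U hU).1 p hp).2.1
    have hxV : x ∈ ⋃ U ∈ S, ⋃ p ∈ U, Set.Ioo p.1 p.2 :=
      Set.mem_biUnion hU (Set.mem_biUnion hp hx)
    obtain ⟨c, d, hcd, hc, hd, hC⟩ := exists_connectedComponentIn_eq_Ioo hSlc hchain hxV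
    have hpx : p ∈ intervalsAt S x := ⟨U, hU, hp, hx⟩
    exact ⟨(c, d), ⟨hcd, x, hxV, hC⟩, Set.Ioo_subset_Ioo
      (hc.1 (Set.mem_image_of_mem _ hpx)) (hd.1 (Set.mem_image_of_mem _ hpx))⟩
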